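/- Let (Γ_a)_{a=0}^{10} be a Majorana representation and let ψ, ξ ∈ ℝ³² with ψ ≠ 0. If (ψ̄ Γ_{a₁} ξ) = 0 for all a₁, (ψ̄ Γ_{a₁a₂} ξ) = 0 for all a₁, a₂, and (ψ̄ Γ_{a₁⋯a₅} ξ) = 0 for all a₁,…,a₅ in {0,…,10}, then ξ = 0. -/

import Mathlib

open Matrix BigOperators

noncomputable section

/-- The 11×11 Minkowski metric `η = diag(−1,+1,…,+1)`. -/
def eta (a b : Fin 11) : ℝ :=
  if a = b then (if a = 0 then -1 else 1) else 0

/-- The 11d Clifford relations `Γ_a Γ_b + Γ_b Γ_a = 2 η_{ab} · 1`. -/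
def CliffordRel {A : Type*} [Ring A] [Algebra ℝ A] (Γ : Fin 11 → A) : Prop :=
  ∀ a b : Fin 11, Γ a * Γ b + Γ b * Γ a = (2 * eta a b) • (1 : A)

/-- The antisymmetrized Clifford element
`Γ_{a₁⋯a_p} = (1/p!) Σ_{σ ∈ S_p} sgn(σ) Γ_{a_{σ(1)}} ⋯ Γ_{a_{σ(p)}}`. -/
def gammaA {A : Type*} [Ring A] [Algebra ℝ A] (Γ : Fin 11 → A) (p : ℕ)
    (a : Fin p → Fin 11) : A :=
  (p.factorial : ℝ)⁻¹ • ∑ σ : Equiv.Perm (Fin p),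
    ((Equiv.Perm.sign σ : ℤ) : ℝ) • (List.ofFn fun i => Γ (a (σ i))).prod

/-- The Levi-Civita symbol (lower indices): the sign of `(a₁,…,a₁₁)` as a permutation
of `(0,…,10)`, and `0` if two indices coincide; in particular `ε_{0 1 ⋯ 10} = +1`. -/
def epsL (a : Fin 11 → Fin 11) : ℝ :=
  ∑ σ : Equiv.Perm (Fin 11),
    if (∀ i, a i = σ i) then ((Equiv.Perm.sign σ : ℤ) : ℝ) else 0
/-- A Majorana representation: real 32×32 matrices satisfying the 11d Clifford relations
`Γ_a Γ_b + Γ_b Γ_a = 2 η_{ab} · Id`, the volume normalization `Γ₀ Γ₁ ⋯ Γ₁₀ = Id`,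
and the symmetry condition `Γ_aᵀ = Γ₀ Γ_a Γ₀`. -/
def Majorana (Γ : Fin 11 → Matrix (Fin 32) (Fin 32) ℝ) : Prop :=
  CliffordRel Γ ∧ (List.ofFn Γ).prod = 1 ∧ ∀ a, (Γ a)ᵀ = Γ 0 * Γ a * Γ 0

/-- The Majorana spinor pairing `(ψ̄ M φ) := ψᵀ Γ₀ M φ`; for `M = 1` this is `(ψ̄ φ)`. -/
def pair (Γ : Fin 11 → Matrix (Fin 32) (Fin 32) ℝ) (M : Matrix (Fin 32) (Fin 32) ℝ)
    (ψ φ : Fin 32 → ℝ) : ℝ :=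
  ψ ⬝ᵥ (Γ 0 * M).mulVec φ

theorem prod_ofFn_swap {A : Type*} [Ring A] : ∀ {n : ℕ} (x : Fin (n + 1) → A)
    (_ : ∀ i j, i ≠ j → x i * x j = -(x j * x i)) (i : Fin n),
    (List.ofFn fun k => x (Equiv.swap i.castSucc i.succ k)).prod = -(List.ofFn x).prod
  | 0, _, _, i => i.elim0
  | n + 1, x, hx, i => by
    refine Fin.cases ?_ (fun j => ?_) i
    · have hfix : ∀ k : Fin n, Equiv.swap (0 : Fin (n + 2)) 1 k.succ.succ = k.succ.succ :=
        fun k => Equiv.swap_apply_of_ne_of_ne (Fin.succ_ne_zero _) (by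
          rw [← Fin.succ_zero_eq_one]
          exact fun h => Fin.succ_ne_zero _ (Fin.succ_injective _ h))
      simp only [List.ofFn_succ, List.prod_cons, Fin.castSucc_zero, Fin.succ_zero_eq_one, hfix,
        Equiv.swap_apply_left, Equiv.swap_apply_right]
      rw [← mul_assoc, ← mul_assoc, hx 1 0 (by simp), neg_mul]
    · have ih := prod_ofFn_swap (fun k => x k.succ)
        (fun a b hab => hx _ _ fun h => hab (Fin.succ_injective _ h)) j
      have hzero : Equiv.swap j.succ.castSucc j.succ.succ 0 = 0 :=
        Equiv.swap_apply_of_ne_of_ne (by simp [Fin.ext_iff]) (by simp [Fin.ext_iff])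
      have hsucc : ∀ k : Fin (n + 1), Equiv.swap j.succ.castSucc j.succ.succ k.succ
          = (Equiv.swap j.castSucc j.succ k).succ := fun k => by
        rw [← Fin.succ_castSucc]
        exact (Fin.succ_injective _).swap_apply _ _ _
      rw [List.ofFn_succ, List.ofFn_succ (f := x)]
      simp only [hzero, hsucc, List.prod_cons]
      rw [ih, mul_neg]

/-- Elements that pairwise anticommute satisfy `x_{σ(1)} ⋯ x_{σ(p)} = sgn(σ) x_1 ⋯ x_p`. -/
theorem prod_ofFn_perm {A : Type*} [Ring A] [Algebra ℝ A] {n : ℕ} (σ : Equiv.Perm (Fin n))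
    (x : Fin n → A) (hx : ∀ i j, i ≠ j → x i * x j = -(x j * x i)) :
    (List.ofFn fun i => x (σ i)).prod
      = ((Equiv.Perm.sign σ : ℤ) : ℝ) • (List.ofFn x).prod := by
  cases n with
  | zero => simp [Subsingleton.elim σ 1]
  | succ n =>
    have hσ : σ ∈ Submonoid.closure
        (Set.range fun i : Fin n => Equiv.swap i.castSucc i.succ) := by
      rw [Equiv.Perm.mclosure_swap_castSucc_succ]; trivial
    induction hσ using Submonoid.closure_induction generalizing x with
    | mem τ hτ =>
      obtain ⟨i, rfl⟩ := hτ
      rw [prod_ofFn_swap x hx i, Equiv.Perm.sign_swap Fin.castSucc_lt_succ.ne]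
      simp
    | one => simp
    | mul σ τ _ _ ihσ ihτ =>
      have h := ihτ (fun i => x (σ i)) fun i j hij => hx _ _ (σ.injective.ne hij)
      simp only [Equiv.Perm.mul_apply]
      rw [h, ihσ x hx, smul_smul]
      simp [mul_comm]

theorem CliffordRel.anticomm {A : Type*} [Ring A] [Algebra ℝ A] {Γ : Fin 11 → A}
    (hΓ : CliffordRel Γ) {a b : Fin 11} (hab : a ≠ b) : Γ a * Γ b = -(Γ b * Γ a) := by
  have h := hΓ a b
  simp only [eta, if_neg hab, mul_zero, zero_smul] at h
  exact eq_neg_of_add_eq_zero_left h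

theorem CliffordRel.sq {A : Type*} [Ring A] [Algebra ℝ A] {Γ : Fin 11 → A}
    (hΓ : CliffordRel Γ) (a : Fin 11) : Γ a * Γ a = eta a a • (1 : A) := by
  have h := hΓ a a
  rw [← two_smul ℝ, mul_smul] at h
  exact smul_right_injective A (two_ne_zero (α := ℝ)) h

theorem eta_self_ne_zero (a : Fin 11) : eta a a ≠ 0 := by
  rw [eta, if_pos rfl]; split_ifs <;> norm_num

/-- The ordered product `Γ_{a₁} ⋯ Γ_{a_p}` along a list of indices. -/
def gammaProd {A : Type*} [Ring A] (Γ : Fin 11 → A) (l : List (Fin 11)) : A :=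
  (l.map Γ).prod

section GammaProd

variable {A : Type*} [Ring A] {Γ : Fin 11 → A}

@[simp] theorem gammaProd_nil : gammaProd Γ [] = 1 := rfl

@[simp] theorem gammaProd_cons (a : Fin 11) (l : List (Fin 11)) :
    gammaProd Γ (a :: l) = Γ a * gammaProd Γ l := by simp [gammaProd]

@[simp] theorem gammaProd_append (l l' : List (Fin 11)) :
    gammaProd Γ (l ++ l') = gammaProd Γ l * gammaProd Γ l' := by simp [gammaProd]

variable [Algebra ℝ A]

theorem gammaA_get (hΓ : CliffordRel Γ) {l : List (Fin 11)} (hl : l.Nodup) :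
    gammaA Γ l.length l.get = gammaProd Γ l := by
  have hx : ∀ i j, i ≠ j → Γ (l.get i) * Γ (l.get j) = -(Γ (l.get j) * Γ (l.get i)) :=
    fun i j hij => hΓ.anticomm ((List.nodup_iff_injective_get.mp hl).ne hij)
  have hprod : (List.ofFn fun i => Γ (l.get i)).prod = gammaProd Γ l := by
    rw [gammaProd, ← Function.comp_def, ← List.map_ofFn, List.ofFn_get]
  have hsign : ∀ σ : Equiv.Perm (Fin l.length),
      ((Equiv.Perm.sign σ : ℤ) : ℝ) * ((Equiv.Perm.sign σ : ℤ) : ℝ) = 1 := fun σ => by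
    rw [← Int.cast_mul, ← Units.val_mul, Int.units_mul_self]; simp
  simp only [gammaA, prod_ofFn_perm _ (fun i => Γ (l.get i)) hx, smul_smul, hsign, hprod]
  rw [Finset.sum_const, Finset.card_univ, Fintype.card_perm, Fintype.card_fin, one_smul,
    ← Nat.cast_smul_eq_nsmul ℝ, smul_smul, inv_mul_cancel₀ (by positivity), one_smul]

theorem mul_gammaProd (hΓ : CliffordRel Γ) (a : Fin 11) (l : List (Fin 11)) :
    Γ a * gammaProd Γ l = (-1 : ℝ) ^ (l.length + l.count a) • (gammaProd Γ l * Γ a) := by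
  induction l with
  | nil => simp
  | cons b l ih =>
    by_cases hab : a = b
    · subst hab
      rw [gammaProd_cons, mul_assoc (Γ a) _ (Γ a)]
      nth_rw 1 [ih]
      rw [mul_smul_comm]
      simp only [List.length_cons, List.count_cons_self]
      congr 1
      ring
    · rw [gammaProd_cons, ← mul_assoc, hΓ.anticomm hab, neg_mul, mul_assoc, ih, mul_smul_comm,
        ← mul_assoc, List.count_cons_of_ne (Ne.symm hab), List.length_cons, ← neg_smul]
      congr 1
      ring

theorem gammaProd_reverse (hΓ : CliffordRel Γ) {l : List (Fin 11)} (hl : l.Nodup) :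
    gammaProd Γ l.reverse = (-1 : ℝ) ^ l.length.choose 2 • gammaProd Γ l := by
  induction l with
  | nil => simp
  | cons a l ih =>
    obtain ⟨ha, hl⟩ := List.nodup_cons.mp hl
    rw [List.reverse_cons, gammaProd_append, ih hl, gammaProd_cons, gammaProd_nil, mul_one,
      gammaProd_cons, mul_gammaProd hΓ, List.count_eq_zero_of_not_mem ha, smul_smul,
      smul_mul_assoc, List.length_cons, Nat.choose_succ_succ' l.length 1, Nat.choose_one_right]
    congr 1
    rw [add_zero, pow_add, mul_comm ((-1 : ℝ) ^ l.length), mul_assoc, ← mul_pow]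
    simp

theorem gammaProd_mul_reverse (hΓ : CliffordRel Γ) (l : List (Fin 11)) :
    ∃ c : ℝ, c ≠ 0 ∧ gammaProd Γ l * gammaProd Γ l.reverse = c • (1 : A) := by
  induction l with
  | nil => exact ⟨1, one_ne_zero, by simp⟩
  | cons a l ih =>
    obtain ⟨c, hc, h⟩ := ih
    refine ⟨c * eta a a, mul_ne_zero hc (eta_self_ne_zero a), ?_⟩
    rw [List.reverse_cons, gammaProd_append, gammaProd_cons, gammaProd_cons, gammaProd_nil,
      mul_one, mul_assoc, ← mul_assoc (gammaProd Γ l), h, smul_one_mul, mul_smul_comm, hΓ.sq,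
      smul_smul]

end GammaProd

section Trace

variable {Γ : Fin 11 → Matrix (Fin 32) (Fin 32) ℝ}

theorem trace_gammaProd_eq_zero (hΓ : CliffordRel Γ) {l : List (Fin 11)} {a : Fin 11}
    (ha : Odd (l.length + l.count a)) : (gammaProd Γ l).trace = 0 := by
  have h := congrArg (fun M => (M * Γ a).trace) (mul_gammaProd hΓ a l)
  simp only [ha.neg_one_pow, neg_smul, one_smul] at h
  rw [Matrix.trace_mul_comm, ← mul_assoc, hΓ.sq, neg_mul, mul_assoc, hΓ.sq, smul_one_mul,
    mul_smul_one, Matrix.trace_neg, Matrix.trace_smul, smul_eq_mul] at h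
  have h' : eta a a * (gammaProd Γ l).trace = 0 := by linarith
  exact (mul_eq_zero.mp h').resolve_left (eta_self_ne_zero a)

theorem trace_gammaProd_mul_eq_zero (hΓ : CliffordRel Γ) {S T : Finset (Fin 11)} (hST : S ≠ T)
    (hcard : S.card + T.card ≤ 10) :
    (gammaProd Γ S.toList * gammaProd Γ T.toList).trace = 0 := by
  have hcount : ∀ (U : Finset (Fin 11)) (a : Fin 11),
      U.toList.count a = if a ∈ U then 1 else 0 := fun U a => by
    simp [List.Nodup.count U.nodup_toList]
  rw [← gammaProd_append]
  rcases Nat.even_or_odd (S.card + T.card) with he | ho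
  · obtain ⟨a, ha⟩ : ∃ a, ¬(a ∈ S ↔ a ∈ T) := by
      by_contra! h
      exact hST (Finset.ext h)
    refine trace_gammaProd_eq_zero hΓ (a := a) ?_
    rw [List.length_append, List.count_append, Finset.length_toList, Finset.length_toList,
      hcount, hcount]
    refine he.add_odd ?_
    by_cases hS : a ∈ S <;> by_cases hT : a ∈ T <;> simp_all
  · obtain ⟨a, ha⟩ : ∃ a, a ∉ S ∪ T := by
      by_contra! h
      have h₁ := Finset.card_union_le S T
      rw [Finset.eq_univ_iff_forall.mpr h, Finset.card_univ, Fintype.card_fin] at h₁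
      omega
    rw [Finset.mem_union, not_or] at ha
    refine trace_gammaProd_eq_zero hΓ (a := a) ?_
    rw [List.length_append, List.count_append, Finset.length_toList, Finset.length_toList,
      hcount, hcount]
    simpa [ha.1, ha.2] using ho

theorem trace_gammaProd_mul_self_ne_zero (hΓ : CliffordRel Γ) (S : Finset (Fin 11)) :
    (gammaProd Γ S.toList * gammaProd Γ S.toList).trace ≠ 0 := by
  obtain ⟨c, hc, h⟩ := gammaProd_mul_reverse hΓ S.toList
  intro h0
  rw [gammaProd_reverse hΓ S.nodup_toList, mul_smul_comm] at h
  have := congrArg Matrix.trace h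
  simp [Matrix.trace_smul, h0, hc] at this

theorem linearIndependent_gammaProd (hΓ : CliffordRel Γ) :
    LinearIndependent ℝ
      fun S : {S : Finset (Fin 11) // S.card ≤ 5} => gammaProd Γ S.1.toList := by
  rw [Fintype.linearIndependent_iff]
  intro g hg T
  have h := congrArg (fun M => (M * gammaProd Γ T.1.toList).trace) hg
  simp only [Finset.sum_mul, Matrix.trace_sum, smul_mul_assoc, Matrix.trace_smul, zero_mul,
    Matrix.trace_zero] at h
  rw [Finset.sum_eq_single T (fun S _ hST => by
    rw [trace_gammaProd_mul_eq_zero hΓ (fun h => hST (Subtype.ext h))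
      (by have := S.2; have := T.2; omega), smul_zero]) (by simp)] at h
  exact (mul_eq_zero.mp h).resolve_right (trace_gammaProd_mul_self_ne_zero hΓ _)

theorem card_finset_card_le_five :
    Fintype.card {S : Finset (Fin 11) // S.card ≤ 5} = 1024 := by
  have hcompl : Fintype.card {S : Finset (Fin 11) // S.card ≤ 5}
      = Fintype.card {S : Finset (Fin 11) // ¬S.card ≤ 5} :=
    Fintype.card_congr (Equiv.subtypeEquiv (compl_involutive.toPerm compl) fun S => by
      have := Finset.card_le_univ S
      rw [Fintype.card_fin] at this
      simp only [Function.Involutive.coe_toPerm, Finset.card_compl, Fintype.card_fin]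
      omega)
  have hsum := Fintype.card_subtype_compl fun S : Finset (Fin 11) => S.card ≤ 5
  have hle := Fintype.card_subtype_le fun S : Finset (Fin 11) => S.card ≤ 5
  have htot : Fintype.card (Finset (Fin 11)) = 2048 := by simp
  omega

/-- Products of at most five distinct gamma matrices span all `32 × 32` matrices. -/
theorem span_gammaProd (hΓ : CliffordRel Γ) :
    Submodule.span ℝ (Set.range
      fun S : {S : Finset (Fin 11) // S.card ≤ 5} => gammaProd Γ S.1.toList) = ⊤ := by
  have : Nonempty {S : Finset (Fin 11) // S.card ≤ 5} := ⟨⟨∅, by simp⟩⟩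
  exact (linearIndependent_gammaProd hΓ).span_eq_top_of_card_eq_finrank (by
    simp [card_finset_card_le_five, Module.finrank_matrix])

end Trace

section Transpose

variable {Γ : Fin 11 → Matrix (Fin 32) (Fin 32) ℝ}

theorem Majorana.sq_zero (hM : Majorana Γ) : Γ 0 * Γ 0 = -1 := by
  simp [hM.1.sq 0, eta]

theorem Majorana.gammaProd_transpose (hM : Majorana Γ) (l : List (Fin 11)) :
    (gammaProd Γ l)ᵀ
      = (-1 : ℝ) ^ (l.length + 1) • (Γ 0 * gammaProd Γ l.reverse * Γ 0) := by
  induction l with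
  | nil => simp [hM.sq_zero]
  | cons a l ih =>
    have h : Γ 0 * gammaProd Γ l.reverse * Γ 0 * (Γ 0 * Γ a * Γ 0)
        = -(Γ 0 * (gammaProd Γ l.reverse * Γ a) * Γ 0) := by
      calc _ = Γ 0 * gammaProd Γ l.reverse * (Γ 0 * Γ 0) * Γ a * Γ 0 := by
            simp only [mul_assoc]
        _ = _ := by rw [hM.sq_zero]; simp only [mul_neg, mul_one, neg_mul, mul_assoc]
    rw [gammaProd_cons, Matrix.transpose_mul, ih, hM.2.2 a, smul_mul_assoc, h,
      List.reverse_cons, gammaProd_append, gammaProd_cons, gammaProd_nil, mul_one,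
      List.length_cons, pow_succ _ (l.length + 1), mul_neg_one, neg_smul, smul_neg]

theorem Majorana.zero_mul_gammaProd_transpose (hM : Majorana Γ) {l : List (Fin 11)}
    (hl : l.Nodup) :
    (Γ 0 * gammaProd Γ l)ᵀ
      = (-1 : ℝ) ^ (l.length + 1 + l.length.choose 2) • (Γ 0 * gammaProd Γ l) := by
  have h0 : (Γ 0)ᵀ = -Γ 0 := by rw [hM.2.2 0, hM.sq_zero, neg_one_mul]
  rw [Matrix.transpose_mul, hM.gammaProd_transpose, h0, smul_mul_assoc, mul_neg, mul_assoc,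
    hM.sq_zero, mul_neg_one, neg_neg, gammaProd_reverse hM.1 hl, mul_smul_comm, smul_smul,
    ← pow_add]

end Transpose

theorem pair_swap (Γ : Fin 11 → Matrix (Fin 32) (Fin 32) ℝ) (M : Matrix (Fin 32) (Fin 32) ℝ)
    (ψ φ : Fin 32 → ℝ) : pair Γ M φ ψ = ψ ⬝ᵥ (Γ 0 * M)ᵀ *ᵥ φ := by
  rw [pair, Matrix.mulVec_transpose, dotProduct_comm ψ, ← Matrix.dotProduct_mulVec]

/-- If `(ψ̄ M ξ) + (ξ̄ M ψ)` vanishes for every matrix `M`, one of the spinors vanishes. -/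
theorem eq_zero_of_pair_add_pair_eq_zero {Γ : Fin 11 → Matrix (Fin 32) (Fin 32) ℝ}
    (hM : Majorana Γ) {ψ ξ : Fin 32 → ℝ} (hψ : ψ ≠ 0)
    (h : ∀ M, pair Γ M ψ ξ + pair Γ M ξ ψ = 0) : ξ = 0 := by
  have hentry : ∀ i j, ψ i * ξ j + ξ i * ψ j = 0 := fun i j => by
    have hΓ : Γ 0 * -(Γ 0 * Matrix.single i j (1 : ℝ)) = Matrix.single i j 1 := by
      rw [mul_neg, ← mul_assoc, hM.sq_zero, neg_one_mul, neg_neg]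
    have hij := h (-(Γ 0 * Matrix.single i j 1))
    rw [pair, pair, hΓ] at hij
    simpa [Matrix.single_mulVec, ← Pi.single.eq_1] using hij
  obtain ⟨j, hj⟩ := Function.ne_iff.mp hψ
  have hξj : ξ j = 0 := by
    have : ψ j * ξ j = 0 := by linarith [hentry j j, mul_comm (ψ j) (ξ j)]
    exact (mul_eq_zero.mp this).resolve_left hj
  funext i
  have hi := hentry j i
  rw [hξj, zero_mul, add_zero] at hi
  exact (mul_eq_zero.mp hi).resolve_left hj

/-- Mixed nondegeneracy: if `ψ ≠ 0` and all pairings `(ψ̄ Γ_{a₁} ξ)`, `(ψ̄ Γ_{a₁a₂} ξ)`,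
`(ψ̄ Γ_{a₁⋯a₅} ξ)` vanish, then `ξ = 0`. -/
theorem mixed_nondegeneracy (Γ : Fin 11 → Matrix (Fin 32) (Fin 32) ℝ)
    (hM : Majorana Γ) (ψ ξ : Fin 32 → ℝ) (hψ : ψ ≠ 0)
    (h1 : ∀ a₁ : Fin 11, pair Γ (gammaA Γ 1 ![a₁]) ψ ξ = 0)
    (h2 : ∀ a₁ a₂ : Fin 11, pair Γ (gammaA Γ 2 ![a₁, a₂]) ψ ξ = 0)
    (h5 : ∀ a : Fin 5 → Fin 11, pair Γ (gammaA Γ 5 a) ψ ξ = 0) :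
    ξ = 0 := by
  have hA : ∀ p, p = 1 ∨ p = 2 ∨ p = 5 → ∀ a : Fin p → Fin 11,
      pair Γ (gammaA Γ p a) ψ ξ = 0 := by
    rintro p (rfl | rfl | rfl) a
    · convert h1 (a 0) using 3
      ext i; fin_cases i; rfl
    · convert h2 (a 0) (a 1) using 3
      ext i; fin_cases i <;> rfl
    · exact h5 a
  refine eq_zero_of_pair_add_pair_eq_zero hM hψ fun M => ?_
  have hmem : M ∈ Submodule.span ℝ (Set.range
      fun S : {S : Finset (Fin 11) // S.card ≤ 5} => gammaProd Γ S.1.toList) := by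
    rw [span_gammaProd hM.1]; trivial
  induction hmem using Submodule.span_induction with
  | mem M hM' =>
    obtain ⟨⟨S, hS⟩, rfl⟩ := hM'
    have hT := hM.zero_mul_gammaProd_transpose S.nodup_toList
    have hgamma := gammaA_get hM.1 S.nodup_toList
    have hp := hA S.toList.length
    rw [Finset.length_toList] at hT
    simp only [Finset.length_toList] at hp
    change pair Γ (gammaProd Γ S.toList) ψ ξ + pair Γ (gammaProd Γ S.toList) ξ ψ = 0
    rw [pair_swap Γ _ ψ ξ, hT, Matrix.smul_mulVec, dotProduct_smul, ← pair]
    by_cases hc : S.card = 1 ∨ S.card = 2 ∨ S.card = 5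
    · rw [← hgamma, hp hc, smul_zero, add_zero]
    · have hodd : Odd (S.card + 1 + S.card.choose 2) := by
        generalize S.card = n at hS hc
        interval_cases n <;> first | decide | omega
      rw [hodd.neg_one_pow, neg_one_smul, add_neg_cancel]
  | zero => simp [pair]
  | add M N _ _ hM' hN =>
    simp only [pair, mul_add, Matrix.add_mulVec, dotProduct_add] at hM' hN ⊢
    linear_combination hM' + hN
  | smul c M _ hM' =>
    simp only [pair, mul_smul_comm, Matrix.smul_mulVec, dotProduct_smul, smul_eq_mul] at hM' ⊢
    linear_combination c * hM'

end
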